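/- Let M ≥ 2 and k ≥ 3 be integers such that the critical strip S_M^k exists, i.e. q_{M+1}·k + (M+2)·log 3 < q_M·k − (M+1)·log 3. Then every zero of ζ^(k) inside S_M^k is simple: if a complex number s satisfies q_M·k − (M+1)·log 3 ≤ Re(s) ≤ q_M·k + (M+1)·log 3 and iteratedDeriv k riemannZeta s = 0, then iteratedDeriv (k+1) riemannZeta s ≠ 0. -/

import Mathlib

/-- `q M = log(log M / log(M+1)) / log(M/(M+1))`, the slope of the `M`-th critical line. -/
noncomputable def q (M : ℕ) : ℝ :=
  Real.log (Real.log M / Real.log ((M : ℝ) + 1)) / Real.log ((M : ℝ) / ((M : ℝ) + 1))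


/-- terms of the k-th derivative -/
noncomputable def zterm (k : ℕ) (s : ℂ) (n : ℕ) : ℂ :=
  ((Real.log n : ℝ) : ℂ) ^ k * (n : ℂ) ^ (-s)

lemma logMul_iter (k : ℕ) (n : ℕ) :
    (LSeries.logMul^[k] (1 : ℕ → ℂ)) n = ((Real.log n : ℝ) : ℂ) ^ k := by
  induction k with
  | zero => simp
  | succ k ih =>
    rw [Function.iterate_succ_apply', LSeries.logMul, ih, pow_succ']
    simp [Complex.natCast_log]

lemma zeta_hasSum (k : ℕ) (hk : 1 ≤ k) (s : ℂ) (hs : 1 < s.re)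
    (hz : iteratedDeriv k riemannZeta s = 0) : HasSum (zterm k s) 0 := by
  have hab : LSeries.abscissaOfAbsConv (1 : ℕ → ℂ) < s.re := by
    rw [LSeries.abscissaOfAbsConv_one]; exact_mod_cast hs
  have hev : riemannZeta =ᶠ[nhds s] LSeries 1 := by
    have : {z : ℂ | 1 < z.re} ∈ nhds s :=
      (isOpen_lt continuous_const Complex.continuous_re).mem_nhds hs
    filter_upwards [this] with z hz
    exact (LSeries_one_eq_riemannZeta hz).symm
  rw [hev.iteratedDeriv_eq k, LSeries_iteratedDeriv k hab] at hz
  have h0 : LSeries (LSeries.logMul^[k] 1) s = 0 := by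
    rcases mul_eq_zero.mp hz with h | h
    · exact absurd h (pow_ne_zero _ (by norm_num))
    · exact h
  have hsum : LSeriesSummable (LSeries.logMul^[k] (1 : ℕ → ℂ)) s :=
    LSeriesSummable_of_abscissaOfAbsConv_lt_re
      (by rw [LSeries.absicssaOfAbsConv_logPowMul]; exact hab)
  have := hsum.hasSum
  rw [show (∑' n, LSeries.term (LSeries.logMul^[k] 1) s n) = 0 from h0] at this
  convert this using 1
  funext n
  rcases eq_or_ne n 0 with rfl | hn
  · simp [zterm]; left; omega
  · rw [LSeries.term_of_ne_zero hn, logMul_iter, zterm, Complex.cpow_neg, div_eq_mul_inv]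

lemma zterm_norm (k : ℕ) (s : ℂ) (n : ℕ) (hn : 2 ≤ n) :
    ‖zterm k s n‖ = Real.exp (k * Real.log (Real.log n) - s.re * Real.log n) := by
  have hn0 : (0 : ℝ) < n := by positivity
  have hl : 0 < Real.log n := Real.log_pos (by exact_mod_cast hn)
  rw [zterm, norm_mul, norm_pow, Complex.norm_natCast_cpow_of_pos (by omega),
    Complex.norm_real, Real.norm_of_nonneg hl.le, Real.exp_sub, ← Real.log_pow, Real.exp_log (by positivity),
    Real.rpow_def_of_pos hn0, div_eq_mul_inv, ← Real.exp_neg]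
  simp; left; ring

lemma zterm_small (k : ℕ) (hk : 1 ≤ k) (s : ℂ) (n : ℕ) (hn : n < 2) : zterm k s n = 0 := by
  interval_cases n <;> simp [zterm] <;> omega

/-- geometric bound for finite left sums -/
lemma left_sum (M : ℕ) (G : ℝ) (h0 : 0 ≤ G) (h1 : G < 1) :
    ∑ n ∈ Finset.range M, G ^ (M - n) ≤ G / (1 - G) := by
  have h : ∑ n ∈ Finset.range M, G ^ (M - n) = ∑ n ∈ Finset.range M, G ^ (n + 1) := by
    rw [← Finset.sum_range_reflect]
    apply Finset.sum_congr rfl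
    intro j hj
    rw [Finset.mem_range] at hj
    congr 1; omega
  rw [h]
  have h2 : ∑ n ∈ Finset.range M, G ^ (n + 1) = G * ∑ n ∈ Finset.range M, G ^ n := by
    rw [Finset.mul_sum]; exact Finset.sum_congr rfl fun _ _ => pow_succ' _ _
  rw [h2, div_eq_mul_inv]
  apply mul_le_mul_of_nonneg_left _ h0
  rw [← tsum_geometric_of_lt_one h0 h1]
  exact (summable_geometric_of_lt_one h0 h1).sum_le_tsum _ (fun i _ => pow_nonneg h0 i)

lemma tail_step (K n m : ℝ) (hK : 0 < K) (hn : K ≤ n) (hm : 0 < m) :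
    (K / n) * (1 - Real.exp (-(m * Real.log (1 + 1 / K)))) ≤
      1 - Real.exp (-(m * Real.log (1 + 1 / n))) := by
  have hn0 : 0 < n := by linarith
  set t := K / n with ht
  have ht0 : 0 ≤ t := by positivity
  have ht1 : t ≤ 1 := by rw [ht, div_le_one hn0]; exact hn
  have hlog : t * Real.log (1 + 1 / K) ≤ Real.log (1 + 1 / n) := by
    have := strictConcaveOn_log_Ioi.concaveOn.2 (show (1 : ℝ) ∈ Set.Ioi 0 by simp)
      (show 1 + 1 / K ∈ Set.Ioi (0 : ℝ) from Set.mem_Ioi.mpr (by positivity))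
      (show 0 ≤ 1 - t by linarith) ht0 (by ring)
    simp only [smul_eq_mul, Real.log_one, mul_zero, zero_add] at this
    have e : (1 - t) * 1 + t * (1 + 1 / K) = 1 + 1 / n := by
      rw [ht]; field_simp; ring
    rwa [e] at this
  have hexp := convexOn_exp.2 (Set.mem_univ (0 : ℝ)) (Set.mem_univ (-(m * Real.log (1 + 1 / K))))
      (show 0 ≤ 1 - t by linarith) ht0 (by ring)
  simp only [smul_eq_mul, Real.exp_zero, mul_zero, zero_add] at hexp
  have h3 : Real.exp (-(m * Real.log (1 + 1 / n))) ≤ Real.exp (t * -(m * Real.log (1 + 1 / K))) := by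
    apply Real.exp_le_exp.mpr; nlinarith
  nlinarith

lemma tail_partial (K p : ℝ) (hK : 0 < K) (hp : 1 < p) (J : ℕ) :
    (1 - Real.exp (-((p - 1) * Real.log (1 + 1 / K)))) *
      ∑ j ∈ Finset.range J, Real.exp (-(p * (Real.log (j + K) - Real.log K))) ≤
      1 - Real.exp (-((p - 1) * (Real.log (J + K) - Real.log K))) := by
  induction J with
  | zero => simp
  | succ J ih =>
    rw [Finset.sum_range_succ, mul_add]
    have hn : K ≤ (J : ℝ) + K := by have : (0 : ℝ) ≤ J := by positivity
                                    linarith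
    have hn0 : 0 < (J : ℝ) + K := by linarith
    have st := tail_step K (J + K) (p - 1) hK hn (by linarith)
    set n := (J : ℝ) + K with hn'
    have e1 : Real.log (1 + 1 / n) = Real.log (n + 1) - Real.log n := by
      rw [← Real.log_div (by positivity) (by positivity)]; congr 1; field_simp
    have e2 : (((J + 1 : ℕ) : ℝ) + K) = n + 1 := by push_cast; rw [hn']; ring
    have e3 : Real.exp (-(p * (Real.log n - Real.log K))) =
        (K / n) * Real.exp (-((p - 1) * (Real.log n - Real.log K))) := by
      rw [← Real.exp_log (show 0 < K / n by positivity), ← Real.exp_add,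
        Real.log_div hK.ne' hn0.ne']
      congr 1; ring
    have e4 : Real.exp (-((p - 1) * (Real.log (n + 1) - Real.log K))) =
        Real.exp (-((p - 1) * Real.log (1 + 1 / n))) *
          Real.exp (-((p - 1) * (Real.log n - Real.log K))) := by
      rw [← Real.exp_add, e1]; congr 1; ring
    rw [e2, e3, e4]
    have hpos := Real.exp_pos (-((p - 1) * (Real.log n - Real.log K)))
    nlinarith [mul_le_mul_of_nonneg_right st hpos.le]

lemma log_three_gt : (1.0986 : ℝ) < Real.log 3 := by
  have := Real.lt_log_iff_exp_lt (show (0:ℝ) < 3 by norm_num) (x := 1.0986)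
  rw [this]
  have h : Real.exp 1.0986 = (Real.exp 1) * Real.exp 0.0986 := by rw [← Real.exp_add]; norm_num
  have h1 := Real.exp_one_lt_d9
  have h2 : Real.exp 0.0986 < 1.10363 := by
    have := Real.exp_bound' (x := 0.0986) (by norm_num) (by norm_num) (n := 4) (by norm_num)
    refine lt_of_le_of_lt this ?_
    norm_num [Finset.sum_range_succ, Nat.factorial]
  rw [h]
  nlinarith [Real.exp_pos 1, Real.exp_pos 0.0986]

lemma log_ratio_ge (N : ℝ) (hN : 0 < N) : 2 / (2 * N + 1) ≤ Real.log (1 + 1 / N) := by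
  have := Real.le_log_one_add_of_nonneg (x := 1 / N) (by positivity)
  refine le_trans (le_of_eq ?_) this
  field_simp
  ring

/-- N = K - 1 ≥ 3. -/
lemma tail_bound (N p s : ℝ) (hN : 3 ≤ N) (hs : 0 < s) (hs2 : s ≤ 2 * Real.log 3)
    (hp : N * s + Real.log 3 ≤ p) (J : ℕ) :
    ∑ j ∈ Finset.range J, Real.exp (-(p * (Real.log (j + (N + 1)) - Real.log N))) ≤
      Real.exp (-s) / (1 - Real.exp (-(2 * s / 3))) := by
  have l3 := log_three_gt
  set K := N + 1 with hK
  have hNs : 0 < N * s := by positivity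
  have hp1 : 1 < p := by linarith
  have hpart := tail_partial K p (by linarith) hp1 J
  have hθ : Real.exp (-((p - 1) * Real.log (1 + 1 / K))) ≤ Real.exp (-(2 * s / 3)) := by
    apply Real.exp_le_exp.mpr
    have h1 := log_ratio_ge K (by linarith)
    have h2 : 2 * s / 3 ≤ (p - 1) * (2 / (2 * K + 1)) := by
      rw [mul_div_assoc', le_div_iff₀ (by linarith)]
      nlinarith
    nlinarith
  have hr : Real.exp (-(p * (Real.log K - Real.log N))) ≤ Real.exp (-s) := by
    apply Real.exp_le_exp.mpr
    have h1 := log_ratio_ge N (by linarith)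
    have e1 : Real.log (1 + 1 / N) = Real.log K - Real.log N := by
      rw [← Real.log_div (by positivity) (by positivity)]; congr 1; field_simp; linarith
    rw [e1] at h1
    have h2 : s ≤ p * (2 / (2 * N + 1)) := by
      rw [mul_div_assoc', le_div_iff₀ (by linarith)]
      nlinarith
    nlinarith
  have hlt : Real.exp (-(2 * s / 3)) < 1 := by
    rw [Real.exp_lt_one_iff]; linarith
  have hsplit : ∑ j ∈ Finset.range J, Real.exp (-(p * (Real.log (j + K) - Real.log N))) =
      Real.exp (-(p * (Real.log K - Real.log N))) *
       ∑ j ∈ Finset.range J, Real.exp (-(p * (Real.log (j + K) - Real.log K))) := by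
    rw [Finset.mul_sum]
    apply Finset.sum_congr rfl
    intro j _
    rw [← Real.exp_add]; congr 1; ring
  rw [hsplit, div_eq_mul_inv]
  apply mul_le_mul hr _ (Finset.sum_nonneg fun _ _ => (Real.exp_pos _).le) (Real.exp_pos _).le
  rw [← one_div, le_div_iff₀ (by linarith)]
  have hS : 0 ≤ ∑ j ∈ Finset.range J, Real.exp (-(p * (Real.log (j + K) - Real.log K))) :=
    Finset.sum_nonneg fun _ _ => (Real.exp_pos _).le
  have := Real.exp_pos (-((p - 1) * (Real.log (J + K) - Real.log K)))
  nlinarith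

lemma master (M : ℕ) (hM : 2 ≤ M) (v : ℕ → ℂ) (hv : HasSum v 0) (Cl G Cr p s : ℝ)
    (hCl : 0 ≤ Cl) (hCr : 0 ≤ Cr) (hG0 : 0 ≤ G) (hG1 : G < 1)
    (hs : 0 < s) (hs2 : s ≤ 2 * Real.log 3)
    (hp : ((M : ℝ) + 1) * s + Real.log 3 ≤ p)
    (hl : ∀ n < M, ‖v n‖ ≤ Cl * G ^ (M - n))
    (hr : ∀ n : ℕ, M + 2 ≤ n →
      ‖v n‖ ≤ Cr * Real.exp (-(p * (Real.log n - Real.log ((M : ℝ) + 1))))) :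
    ‖v M‖ ≤ ‖v (M + 1)‖ + Cl * (G / (1 - G)) +
        Cr * (Real.exp (-s) / (1 - Real.exp (-(2 * s / 3)))) ∧
    ‖v (M + 1)‖ ≤ ‖v M‖ + Cl * (G / (1 - G)) +
        Cr * (Real.exp (-s) / (1 - Real.exp (-(2 * s / 3)))) := by
  have hsn : Summable fun n => ‖v n‖ := hv.summable.norm
  have hsh : Summable fun n => ‖v (n + (M + 2))‖ := (summable_nat_add_iff (M + 2)).mpr hsn
  have hM' : (2 : ℝ) ≤ M := by exact_mod_cast hM
  have hR : ‖∑' n, v (n + (M + 2))‖ ≤ Cr * (Real.exp (-s) / (1 - Real.exp (-(2 * s / 3)))) := by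
    refine (norm_tsum_le_tsum_norm hsh).trans ?_
    apply hsh.tsum_le_of_sum_range_le
    intro J
    refine le_trans (Finset.sum_le_sum fun j _ => hr _ (by omega)) ?_
    rw [← Finset.mul_sum]
    apply mul_le_mul_of_nonneg_left _ hCr
    refine le_trans (le_of_eq ?_) (tail_bound (M + 1) p s (by linarith) hs hs2 hp J)
    apply Finset.sum_congr rfl
    intro j _
    push_cast
    ring_nf
  have hL : ‖∑ n ∈ Finset.range M, v n‖ ≤ Cl * (G / (1 - G)) := by
    refine (norm_sum_le _ _).trans ?_
    refine le_trans (Finset.sum_le_sum fun j hj => hl j (Finset.mem_range.mp hj)) ?_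
    rw [← Finset.mul_sum]
    exact mul_le_mul_of_nonneg_left (left_sum M G hG0 hG1) hCl
  have hsum := hv.summable.sum_add_tsum_nat_add (M + 2)
  rw [hv.tsum_eq, Finset.sum_range_succ, Finset.sum_range_succ] at hsum
  set A := ∑ n ∈ Finset.range M, v n
  set B := ∑' n, v (n + (M + 2))
  constructor
  · have : v M = -(v (M + 1) + A + B) := by linear_combination hsum
    rw [this, norm_neg]
    have := norm_add₃_le (a := v (M + 1)) (b := A) (c := B)
    linarith
  · have : v (M + 1) = -(v M + A + B) := by linear_combination hsum
    rw [this, norm_neg]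
    have := norm_add₃_le (a := v M) (b := A) (c := B)
    linarith

lemma log_cast_pos (n : ℕ) (hn : 2 ≤ n) : 0 < Real.log n :=
  Real.log_pos (by exact_mod_cast hn)

lemma log_cast_lt (m n : ℕ) (hm : 1 ≤ m) (h : m < n) : Real.log m < Real.log n :=
  Real.log_lt_log (by exact_mod_cast hm) (by exact_mod_cast h)

lemma log_secant {a x y : ℝ} (ha : 0 < a) (hx : 0 < x) (hy : 0 < y) (hxa : x ≠ a) (hya : y ≠ a)
    (hxy : x ≤ y) : (Real.log y - Real.log a) / (y - a) ≤ (Real.log x - Real.log a) / (x - a) := by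
  have := strictConcaveOn_log_Ioi.concaveOn.neg.secant_mono (Set.mem_Ioi.mpr ha)
    (Set.mem_Ioi.mpr hx) (Set.mem_Ioi.mpr hy) hxa hya hxy
  simp only [Pi.neg_apply] at this
  rw [show -Real.log x - -Real.log a = -(Real.log x - Real.log a) by ring,
    show -Real.log y - -Real.log a = -(Real.log y - Real.log a) by ring, neg_div, neg_div] at this
  linarith

lemma q_eq (M : ℕ) (hM : 2 ≤ M) :
    q M = (Real.log (Real.log ((M + 1 : ℕ) : ℝ)) - Real.log (Real.log M)) /
      (Real.log ((M + 1 : ℕ) : ℝ) - Real.log M) := by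
  have h1 := log_cast_pos M hM
  have h2 := log_cast_pos (M + 1) (by omega)
  have h3 : (0 : ℝ) < M := by positivity
  push_cast at *
  rw [q, Real.log_div h1.ne' h2.ne', Real.log_div h3.ne' (by positivity), ← neg_sub,
    ← neg_sub (Real.log ((M : ℝ) + 1)), neg_div_neg_eq]

lemma q_right (N n : ℕ) (hN : 2 ≤ N) (hn : N + 1 ≤ n) :
    Real.log (Real.log n) - Real.log (Real.log N) ≤ q N * (Real.log n - Real.log N) := by
  have h1 := log_cast_pos N hN
  have h2 := log_cast_pos (N + 1) (by omega)
  have h3 := log_cast_pos n (by omega)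
  have l1 := log_cast_lt N (N + 1) (by omega) (by omega)
  have l2 := log_cast_lt N n (by omega) (by omega)
  have l3 : Real.log ((N + 1 : ℕ) : ℝ) ≤ Real.log n :=
    Real.log_le_log (by positivity) (by exact_mod_cast hn)
  have := log_secant h1 h2 h3 l1.ne' l2.ne' l3
  rw [← q_eq N hN, div_le_iff₀ (by linarith)] at this
  exact this

lemma q_left (M n : ℕ) (hn : 2 ≤ n) (hM : n ≤ M) :
    q M * (Real.log ((M + 1 : ℕ) : ℝ) - Real.log n) ≤
      Real.log (Real.log ((M + 1 : ℕ) : ℝ)) - Real.log (Real.log n) := by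
  have h1 := log_cast_pos n hn
  have h2 := log_cast_pos (M + 1) (by omega)
  have h3 := log_cast_pos M (by omega)
  have l1 := log_cast_lt M (M + 1) (by omega) (by omega)
  have l2 := log_cast_lt n (M + 1) (by omega) (by omega)
  have l3 : Real.log (n : ℝ) ≤ Real.log M :=
    Real.log_le_log (by positivity) (by exact_mod_cast hM)
  have := log_secant h2 h1 h3 l2.ne l1.ne l3
  have e := q_eq M (by omega)
  rw [← neg_div_neg_eq, neg_sub, neg_sub] at this
  rw [← e, ← neg_div_neg_eq, neg_sub, neg_sub, le_div_iff₀ (by linarith)] at this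
  exact this

lemma q_pos (M : ℕ) (hM : 2 ≤ M) : 0 < q M := by
  rw [q_eq M hM]
  have h1 := log_cast_pos M hM
  have l1 := log_cast_lt M (M + 1) (by omega) (by omega)
  exact div_pos (sub_pos.mpr (Real.log_lt_log h1 l1)) (sub_pos.mpr l1)

lemma integral_slope (u v : ℝ) (hu : 0 < u) (huv : u < v) :
    ∫ t in (0 : ℝ)..1, (u + t * (v - u))⁻¹ = (Real.log v - Real.log u) / (v - u) := by
  have hpos : ∀ t ∈ Set.uIcc (0 : ℝ) 1, 0 < u + t * (v - u) := by
    intro t ht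
    rw [Set.uIcc_of_le zero_le_one] at ht
    nlinarith [ht.1, mul_nonneg ht.1 (sub_nonneg.mpr huv.le)]
  have hd : ∀ t ∈ Set.uIcc (0 : ℝ) 1,
      HasDerivAt (fun t => Real.log (u + t * (v - u)) / (v - u)) (u + t * (v - u))⁻¹ t := by
    intro t ht
    have h1 : HasDerivAt (fun t : ℝ => u + t * (v - u)) (v - u) t := by
      simpa using ((hasDerivAt_id t).mul_const (v - u)).const_add u
    have h2 := (h1.log (hpos t ht).ne').div_const (v - u)
    have : v - u ≠ 0 := (sub_pos.mpr huv).ne'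
    rwa [div_div, mul_comm, ← div_div, div_self this, one_div] at h2
  rw [intervalIntegral.integral_eq_sub_of_hasDerivAt hd]
  · simp [sub_div]
  · apply ContinuousOn.intervalIntegrable
    exact ContinuousOn.inv₀ (by fun_prop) (fun t ht => (hpos t ht).ne')

lemma slope_integrable (u v : ℝ) (hu : 0 < u) (huv : u < v) :
    IntervalIntegrable (fun t : ℝ => (u + t * (v - u))⁻¹) MeasureTheory.volume 0 1 := by
  apply ContinuousOn.intervalIntegrable
  refine ContinuousOn.inv₀ (by fun_prop) (fun t ht => ?_)
  rw [Set.uIcc_of_le zero_le_one] at ht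
  nlinarith [ht.1, mul_nonneg ht.1 (sub_nonneg.mpr huv.le)]

lemma log_mid (m : ℕ) (hm : 1 ≤ m) :
    Real.log m + Real.log ((m + 2 : ℕ) : ℝ) ≤ 2 * Real.log ((m + 1 : ℕ) : ℝ) := by
  have h : (0 : ℝ) < m := by exact_mod_cast hm
  push_cast
  rw [← Real.log_mul (by positivity) (by positivity)]
  have : 2 * Real.log ((m : ℝ) + 1) = Real.log (((m : ℝ) + 1) ^ 2) := by
    rw [Real.log_pow]; norm_num
  rw [this]
  apply Real.log_le_log (by positivity)
  nlinarith

lemma q_convex (m : ℕ) (hm : 2 ≤ m) : 2 * q (m + 1) ≤ q m + q (m + 2) := by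
  have h0 := log_cast_pos m hm
  have h1 := log_cast_pos (m + 1) (by omega)
  have h2 := log_cast_pos (m + 2) (by omega)
  have l0 := log_cast_lt m (m + 1) (by omega) (by omega)
  have l1 := log_cast_lt (m + 1) (m + 2) (by omega) (by omega)
  have l2 := log_cast_lt (m + 2) (m + 3) (by omega) (by omega)
  have c0 := log_mid m (by omega)
  have c1 := log_mid (m + 1) (by omega)
  rw [q_eq m hm, q_eq (m + 1) (by omega), q_eq (m + 2) (by omega)]
  rw [show m + 1 + 1 = m + 2 by ring, show m + 2 + 1 = m + 3 by ring] at *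
  rw [show m + 1 + 2 = m + 3 by ring] at c1
  generalize Real.log ((m : ℕ) : ℝ) = a at *
  generalize Real.log ((m + 1 : ℕ) : ℝ) = b at *
  generalize Real.log ((m + 2 : ℕ) : ℝ) = c at *
  generalize Real.log ((m + 3 : ℕ) : ℝ) = d at *
  rw [← integral_slope a b h0 l0, ← integral_slope b c h1 l1, ← integral_slope c d h2 l2,
    ← intervalIntegral.integral_const_mul, ← intervalIntegral.integral_add
      (slope_integrable a b h0 l0) (slope_integrable c d h2 l2)]
  apply intervalIntegral.integral_mono_on zero_le_one ((slope_integrable b c h1 l1).const_mul 2)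
    ((slope_integrable a b h0 l0).add (slope_integrable c d h2 l2))
  intro t ht
  have p0 : 0 < a + t * (b - a) := by nlinarith [ht.1, mul_nonneg ht.1 (sub_nonneg.mpr l0.le)]
  have p1 : 0 < b + t * (c - b) := by nlinarith [ht.1, mul_nonneg ht.1 (sub_nonneg.mpr l1.le)]
  have p2 : 0 < c + t * (d - c) := by nlinarith [ht.1, mul_nonneg ht.1 (sub_nonneg.mpr l2.le)]
  have key : (a + t * (b - a)) + (c + t * (d - c)) ≤ 2 * (b + t * (c - b)) := by
    nlinarith [mul_nonneg (sub_nonneg.mpr ht.2) (sub_nonneg.mpr c0),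
      mul_nonneg ht.1 (sub_nonneg.mpr c1)]
  generalize a + t * (b - a) = X at *
  generalize b + t * (c - b) = Y at *
  generalize c + t * (d - c) = Z at *
  have : 2 * Y⁻¹ ≤ 2 * ((X + Z) / 2)⁻¹ := by
    gcongr; linarith
  refine this.trans ?_
  have e : X⁻¹ + Z⁻¹ - 2 * ((X + Z) / 2)⁻¹ = (X - Z) ^ 2 / (X * Z * (X + Z)) := by
    field_simp; ring
  have : 0 ≤ (X - Z) ^ 2 / (X * Z * (X + Z)) := by positivity
  linarith

lemma log_three_lt : Real.log 3 < (1.0987 : ℝ) := by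
  rw [Real.log_lt_iff_lt_exp (by norm_num)]
  have h : Real.exp 1.0987 = (Real.exp 1) * Real.exp 0.0987 := by rw [← Real.exp_add]; norm_num
  have h1 := Real.exp_one_gt_d9
  have h2 : 1.10371 < Real.exp 0.0987 := by
    have := Real.sum_le_exp_of_nonneg (x := 0.0987) (by norm_num) 4
    refine lt_of_lt_of_le ?_ this
    norm_num [Finset.sum_range_succ, Nat.factorial]
  rw [h]
  nlinarith [Real.exp_pos 1, Real.exp_pos 0.0987]

lemma exp_half_lt : Real.exp (1 / 2) < 1.6488 := by
  have h : Real.exp (1 / 2) ^ 2 = Real.exp 1 := by rw [← Real.exp_nat_mul]; norm_num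
  have h1 := Real.exp_one_lt_d9
  have := Real.exp_pos (1 / 2)
  nlinarith

lemma exp_two_log (ξ : ℝ) : Real.exp (-(2 * Real.log 3 - ξ)) * Real.exp (-ξ) = 1 / 9 := by
  rw [← Real.exp_add, show -(2 * Real.log 3 - ξ) + -ξ = -(Real.log 3 + Real.log 3) by ring,
    Real.exp_neg, Real.exp_add, Real.exp_log (by norm_num)]
  norm_num

lemma num1 (ξ : ℝ) (h1 : ξ ≤ Real.log 3) (hv : Real.exp (-ξ) ≤ 5 / 9) :
    Real.exp (-ξ) + Real.exp (-ξ) * (Real.exp (-ξ) / 9 / (1 - Real.exp (-ξ) / 9)) +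
      Real.exp (-(2 * Real.log 3 - ξ)) / (1 - Real.exp (-(2 * (2 * Real.log 3 - ξ) / 3))) < 1 := by
  have e := exp_two_log ξ
  have hv3 : 1 / 3 ≤ Real.exp (-ξ) := by
    have := Real.exp_le_exp.mpr (neg_le_neg h1)
    rw [Real.exp_neg (Real.log 3), Real.exp_log (by norm_num)] at this
    linarith
  set F := Real.exp (-((2 * Real.log 3 - ξ) / 3)) with hF
  have hF0 : 0 < F := Real.exp_pos _
  have e3 : Real.exp (-(2 * Real.log 3 - ξ)) = F ^ 3 := by
    rw [hF, ← Real.exp_nat_mul]; congr 1; push_cast; ring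
  have e2 : Real.exp (-(2 * (2 * Real.log 3 - ξ) / 3)) = F ^ 2 := by
    rw [hF, ← Real.exp_nat_mul]; congr 1; push_cast; ring
  rw [e3] at e
  rw [e3, e2]
  set v := Real.exp (-ξ)
  have hv' : v = 1 / (9 * F ^ 3) := by field_simp; linarith
  have f1 : F ^ 3 ≤ 1 / 3 := by nlinarith [pow_pos hF0 3]
  have f2 : 1 / 5 ≤ F ^ 3 := by nlinarith [pow_pos hF0 3]
  have g1 : F ≤ 0.6934 := by
    by_contra h; push Not at h
    have := pow_lt_pow_left₀ h (by norm_num) (n := 3) (by norm_num)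
    norm_num at this; linarith
  have g2 : 0.584 ≤ F := by
    by_contra h; push Not at h
    have := pow_lt_pow_left₀ h hF0.le (n := 3) (by norm_num)
    norm_num at this; linarith
  have key : 81*F^6+81*F^5-82*F^3-10*F^2+10 < 0 := by
    have hq : 0 < (F - 0.584) * (0.6934 - F) + 0.0001 := by nlinarith
    nlinarith [mul_nonneg (mul_nonneg (sub_nonneg.mpr g2) (sub_nonneg.mpr g1)) (show 0 ≤ 81 * F^4 + 184*F^3+202*F^2+106*F+45 by positivity)]
  have hd1 : 0 < 81 * F ^ 3 - 1 := by linarith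
  have hd2 : 0 < 1 - F ^ 2 := by nlinarith
  have : v + v * (v / 9 / (1 - v / 9)) = 9 / (81 * F ^ 3 - 1) := by
    have : 0 < 1 - v / 9 := by linarith
    have h8 : v + v * (v / 9 / (1 - v / 9)) = v / (1 - v / 9) := by
      have h7 : v / 9 = 1 - (1 - v / 9) := by ring
      generalize 1 - v / 9 = D at *
      rw [h7]; field_simp; ring
    rw [h8, div_eq_div_iff this.ne' hd1.ne']
    nlinarith
  rw [this, div_add_div _ _ hd1.ne' hd2.ne', div_lt_one (by positivity)]
  nlinarith

lemma num2 (ξ : ℝ) (h0 : 0 ≤ ξ) (hv : 5 / 9 ≤ Real.exp (-ξ)) :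
    Real.exp (-1) * Real.exp (-ξ) * (Real.exp 1 * Real.exp (-ξ) / 9 / (1 - Real.exp 1 * Real.exp (-ξ) / 9)) +
      2 * Real.exp (-(1 / 2)) * (Real.exp (-(2 * Real.log 3 - ξ - 1 / 2)) /
        (1 - Real.exp (-(2 * (2 * Real.log 3 - ξ - 1 / 2) / 3)))) < 1 := by
  have e := exp_two_log ξ
  have hv1 : Real.exp (-ξ) ≤ 1 := by rw [Real.exp_le_one_iff]; linarith
  have he := Real.exp_one_lt_d9
  have hee : Real.exp (-1) * Real.exp 1 = 1 := by rw [← Real.exp_add]; norm_num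
  have t1 : Real.exp (-1) * Real.exp (-ξ) * (Real.exp 1 * Real.exp (-ξ) / 9 / (1 - Real.exp 1 * Real.exp (-ξ) / 9)) ≤ 0.16 := by
    set v := Real.exp (-ξ)
    have hd : 0.69 ≤ 1 - Real.exp 1 * v / 9 := by nlinarith [Real.exp_pos 1]
    have : Real.exp (-1) * v * (Real.exp 1 * v / 9 / (1 - Real.exp 1 * v / 9)) =
       (Real.exp (-1) * Real.exp 1) * (v ^ 2 / 9) / (1 - Real.exp 1 * v / 9) := by ring
    rw [this, hee, div_le_iff₀ (by linarith)]
    have : Real.exp 1 * v ≤ Real.exp 1 := by nlinarith [Real.exp_pos 1]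
    nlinarith
  have hE : Real.exp (-(2 * Real.log 3 - ξ)) ≤ 1 / 5 := by nlinarith [Real.exp_pos (-(2 * Real.log 3 - ξ))]
  set F := Real.exp (-((2 * Real.log 3 - ξ - 1 / 2) / 3)) with hF
  have hF0 : 0 < F := Real.exp_pos _
  have e3 : F ^ 3 = Real.exp (-(2 * Real.log 3 - ξ)) * Real.exp (1 / 2) := by
    rw [hF, ← Real.exp_nat_mul, ← Real.exp_add]; congr 1; push_cast; ring
  have e2 : Real.exp (-(2 * (2 * Real.log 3 - ξ - 1 / 2) / 3)) = F ^ 2 := by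
    rw [hF, ← Real.exp_nat_mul]; congr 1; push_cast; ring
  have e4 : 2 * Real.exp (-(1 / 2)) * (Real.exp (-(2 * Real.log 3 - ξ - 1 / 2)) / (1 - F ^ 2)) =
      2 * Real.exp (-(2 * Real.log 3 - ξ)) / (1 - F ^ 2) := by
    rw [mul_div_assoc', mul_assoc, ← Real.exp_add]; congr 3; ring_nf
  rw [e2, e4]
  have f1 : F ^ 3 ≤ 0.32976 := by
    rw [e3]; nlinarith [exp_half_lt, Real.exp_pos (1 / 2), Real.exp_pos (-(2 * Real.log 3 - ξ))]
  have g1 : F ≤ 0.691 := by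
    by_contra h; push Not at h
    have := pow_lt_pow_left₀ h (by norm_num) (n := 3) (by norm_num)
    norm_num at this; linarith
  have hd : 0.52 ≤ 1 - F ^ 2 := by nlinarith
  have : 2 * Real.exp (-(2 * Real.log 3 - ξ)) / (1 - F ^ 2) ≤ 0.8 := by
    rw [div_le_iff₀ (by linarith)]; nlinarith
  linarith

lemma num3 (ξ : ℝ) (h1 : ξ ≤ Real.log 3) (hv : Real.exp (-ξ) ≤ 5 / 9) :
    Real.exp (-ξ) + (Real.exp (-(2 * Real.log 3 - ξ)) / (1 - Real.exp (-(2 * Real.log 3 - ξ)))) +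
      Real.exp (-ξ) * (Real.exp (-(2 * Real.log 3)) / (1 - Real.exp (-(2 * (2 * Real.log 3) / 3)))) < 1 := by
  have e := exp_two_log ξ
  have e0 := exp_two_log 0
  have hv3 : 1 / 3 ≤ Real.exp (-ξ) := by
    have := Real.exp_le_exp.mpr (neg_le_neg h1)
    rw [Real.exp_neg (Real.log 3), Real.exp_log (by norm_num)] at this
    linarith
  simp only [sub_zero, neg_zero, Real.exp_zero, mul_one] at e0
  set F := Real.exp (-((2 * Real.log 3) / 3)) with hF
  have hF0 : 0 < F := Real.exp_pos _
  have e3 : F ^ 3 = 1 / 9 := by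
    rw [← e0, hF, ← Real.exp_nat_mul]; congr 1; push_cast; ring
  have e2 : Real.exp (-(2 * (2 * Real.log 3) / 3)) = F ^ 2 := by
    rw [hF, ← Real.exp_nat_mul]; congr 1; push_cast; ring
  rw [e2, e0]
  have g1 : F ≤ 0.484 := by
    by_contra h; push Not at h
    have := pow_lt_pow_left₀ h (by norm_num) (n := 3) (by norm_num)
    norm_num at this; linarith
  have hc : (1 / 9) / (1 - F ^ 2) ≤ 0.15 := by
    rw [div_le_iff₀ (by nlinarith)]; nlinarith
  set v := Real.exp (-ξ)
  have hE : Real.exp (-(2 * Real.log 3 - ξ)) = 1 / (9 * v) := by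
    field_simp; linarith
  have h4 : Real.exp (-(2 * Real.log 3 - ξ)) / (1 - Real.exp (-(2 * Real.log 3 - ξ))) = 1 / (9 * v - 1) := by
    have h6 : 9 * v - 1 ≠ 0 := by linarith
    have h7 : v ≠ 0 := by linarith
    have h5 : 1 - 1 / (9 * v) = (9 * v - 1) / (9 * v) := by field_simp
    rw [hE, h5]; field_simp
  rw [h4]
  have : 1 / (9 * v - 1) < 1 - 1.15 * v := by
    rw [div_lt_iff₀ (by linarith)]; nlinarith
  nlinarith

lemma num4 (ξ : ℝ) (h0 : 0 ≤ ξ) (hv : 5 / 9 ≤ Real.exp (-ξ)) :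
    2 * Real.exp (-(1 / 2)) * (Real.exp (-(2 * Real.log 3 - ξ - 1 / 2)) /
        (1 - Real.exp (-(2 * Real.log 3 - ξ - 1 / 2)))) +
    Real.exp (-1) * Real.exp (-ξ) * (Real.exp (-(2 * Real.log 3 - 1)) /
        (1 - Real.exp (-(2 * (2 * Real.log 3 - 1) / 3)))) < 1 := by
  have e := exp_two_log ξ
  have e0 := exp_two_log 0
  simp only [sub_zero, neg_zero, Real.exp_zero, mul_one] at e0
  have hv1 : Real.exp (-ξ) ≤ 1 := by rw [Real.exp_le_one_iff]; linarith
  have he := Real.exp_one_lt_d9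
  have hE : Real.exp (-(2 * Real.log 3 - ξ)) ≤ 1 / 5 := by nlinarith [Real.exp_pos (-(2 * Real.log 3 - ξ))]
  have e3 : Real.exp (-(2 * Real.log 3 - ξ - 1 / 2)) = Real.exp (-(2 * Real.log 3 - ξ)) * Real.exp (1 / 2) := by
    rw [← Real.exp_add]; congr 1; ring
  have f1 : Real.exp (-(2 * Real.log 3 - ξ - 1 / 2)) ≤ 0.32976 := by
    rw [e3]; nlinarith [exp_half_lt, Real.exp_pos (1 / 2), Real.exp_pos (-(2 * Real.log 3 - ξ))]
  have e4 : 2 * Real.exp (-(1 / 2)) * (Real.exp (-(2 * Real.log 3 - ξ - 1 / 2)) /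
        (1 - Real.exp (-(2 * Real.log 3 - ξ - 1 / 2)))) =
      2 * Real.exp (-(2 * Real.log 3 - ξ)) / (1 - Real.exp (-(2 * Real.log 3 - ξ - 1 / 2))) := by
    rw [mul_div_assoc', mul_assoc, ← Real.exp_add]; congr 3; ring_nf
  have t1 : 2 * Real.exp (-(2 * Real.log 3 - ξ)) / (1 - Real.exp (-(2 * Real.log 3 - ξ - 1 / 2))) ≤ 0.6 := by
    rw [div_le_iff₀ (by linarith)]; linarith
  rw [e4]
  set F := Real.exp (-((2 * Real.log 3 - 1) / 3)) with hF
  have hF0 : 0 < F := Real.exp_pos _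
  have e5 : F ^ 3 = Real.exp (-(2 * Real.log 3)) * Real.exp 1 := by
    rw [hF, ← Real.exp_nat_mul, ← Real.exp_add]; congr 1; push_cast; ring
  have e2 : Real.exp (-(2 * (2 * Real.log 3 - 1) / 3)) = F ^ 2 := by
    rw [hF, ← Real.exp_nat_mul]; congr 1; push_cast; ring
  have g1 : F ≤ 0.672 := by
    by_contra h; push Not at h
    have := pow_lt_pow_left₀ h (by norm_num) (n := 3) (by norm_num)
    rw [e5, e0] at this
    norm_num at this; linarith
  have e6 : Real.exp (-1) * Real.exp (-ξ) * (Real.exp (-(2 * Real.log 3 - 1)) / (1 - F ^ 2)) =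
      Real.exp (-ξ) * (1 / 9) / (1 - F ^ 2) := by
    rw [← e0, show -(2 * Real.log 3) = -1 + -(2 * Real.log 3 - 1) by ring, Real.exp_add]; ring
  rw [e2, e6]
  have : Real.exp (-ξ) * (1 / 9) / (1 - F ^ 2) ≤ 0.3 := by
    rw [div_le_iff₀ (by nlinarith)]; nlinarith
  linarith

lemma log_gap_left (M n : ℕ) (hn : 1 ≤ n) (h : n < M) :
    ((M - n : ℕ) : ℝ) ≤ M * (Real.log M - Real.log n) := by
  have hn0 : (0 : ℝ) < n := by exact_mod_cast hn
  have hM0 : (0 : ℝ) < M := by exact_mod_cast (by omega : 0 < M)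
  have := Real.log_le_sub_one_of_pos (show (0 : ℝ) < n / M by positivity)
  rw [Real.log_div hn0.ne' hM0.ne'] at this
  rw [Nat.cast_sub h.le]
  have e : (n : ℝ) / M * M = n := by field_simp
  nlinarith

lemma exp_pow_le (M i : ℕ) (ρ c y : ℝ) (hc : 0 ≤ c) (hρ : M * c ≤ ρ) (hy0 : 0 ≤ y)
    (hy : (i : ℝ) ≤ M * y) : Real.exp (-(ρ * y)) ≤ Real.exp (-c) ^ i := by
  rw [← Real.exp_nat_mul]
  apply Real.exp_le_exp.mpr
  nlinarith [mul_le_mul_of_nonneg_right hρ hy0, mul_le_mul_of_nonneg_left hy hc]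

/-- weights: `y ≤ h e^{-1} e^{N y}` -/
lemma weight1 (N h y : ℝ) (hN : 0 < N) (hh : 1 ≤ N * h) :
    y ≤ h * Real.exp (-1) * Real.exp (N * y) := by
  have h1 := Real.add_one_le_exp (N * y - 1)
  have e : Real.exp (-1) * Real.exp (N * y) = Real.exp (N * y - 1) := by
    rw [← Real.exp_add]; congr 1; ring
  rw [mul_assoc, e]
  have h2 := Real.exp_pos (N * y - 1)
  have : N * y ≤ N * (h * Real.exp (N * y - 1)) := by nlinarith
  exact le_of_mul_le_mul_left this hN

lemma weight2 (N h y : ℝ) (hh : 1 ≤ N * h) (hh0 : 0 < h) (hy : 0 ≤ y) :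
    h + y ≤ h * (2 * Real.exp (-(1 / 2))) * Real.exp (N / 2 * y) := by
  have h1 := Real.add_one_le_exp (N * y / 2 - 1 / 2)
  have e : Real.exp (-(1 / 2)) * Real.exp (N / 2 * y) = Real.exp (N * y / 2 - 1 / 2) := by
    rw [← Real.exp_add]; congr 1; ring
  have e' : h * (2 * Real.exp (-(1 / 2))) * Real.exp (N / 2 * y) =
      2 * h * (Real.exp (-(1 / 2)) * Real.exp (N / 2 * y)) := by ring
  rw [e', e]
  nlinarith

/-- combine a bound on the coefficient with a bound on the weight -/
lemma combine (b B w W a c y : ℝ) (hw : 0 ≤ w) (hB : 0 ≤ B)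
    (hb : b ≤ B * Real.exp (-(a * y))) (hW : w ≤ W * Real.exp (c * y)) :
    w * b ≤ W * B * Real.exp (-((a - c) * y)) := by
  have e : Real.exp (-((a - c) * y)) = Real.exp (c * y) * Real.exp (-(a * y)) := by
    rw [← Real.exp_add]; congr 1; ring
  calc w * b ≤ w * (B * Real.exp (-(a * y))) := mul_le_mul_of_nonneg_left hb hw
    _ ≤ (W * Real.exp (c * y)) * (B * Real.exp (-(a * y))) :=
      mul_le_mul_of_nonneg_right hW (by positivity)
    _ = _ := by rw [e]; ring

set_option maxHeartbeats 2000000 in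
/-- The analytic core. -/
lemma core (M : ℕ) (hM : 2 ≤ M) (u : ℕ → ℂ) (hu : HasSum u 0)
    (hu' : HasSum (fun n : ℕ => ((Real.log n : ℝ) : ℂ) * u n) 0)
    (hsm : ∀ n < 2, u n = 0) (x : ℝ)
    (hx1 : -(((M : ℝ) + 1) * Real.log 3) ≤ x) (hx2 : x ≤ ((M : ℝ) + 1) * Real.log 3)
    (hpos : 0 < ‖u M‖)
    (hMN : ‖u M‖ = ‖u (M + 1)‖ * Real.exp (x * (Real.log ((M : ℝ) + 1) - Real.log M)))
    (hR : ∀ n : ℕ, M + 2 ≤ n → ‖u n‖ ≤ ‖u (M + 1)‖ *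
      Real.exp (-(((2 * M + 3) * Real.log 3 + x) * (Real.log n - Real.log ((M : ℝ) + 1)))))
    (hL : ∀ n : ℕ, 2 ≤ n → n < M → ‖u n‖ ≤ ‖u M‖ *
      Real.exp (-(((2 * M + 3) * Real.log 3 - x) * (Real.log M - Real.log n)))) : False := by
  have l3 := log_three_gt
  have l3' := log_three_lt
  have hM' : (2 : ℝ) ≤ M := by exact_mod_cast hM
  have hN0 : (0 : ℝ) < (M : ℝ) + 1 := by linarith
  set lam := Real.log 3 with hlam
  set N : ℝ := (M : ℝ) + 1 with hN
  set h := Real.log N - Real.log M with hh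
  have hNh : 1 ≤ N * h := by
    have h1 := log_ratio_ge M (by linarith)
    have e1 : Real.log (1 + 1 / (M : ℝ)) = h := by
      rw [hh, ← Real.log_div (by positivity) (by positivity)]; congr 1; field_simp; linarith
    rw [e1, div_le_iff₀ (by linarith)] at h1
    nlinarith
  have hh0 : 0 < h := by
    by_contra hc; push Not at hc; nlinarith
  have hBpos : 0 < ‖u (M + 1)‖ := by
    by_contra hc
    have : ‖u (M + 1)‖ = 0 := le_antisymm (not_lt.mp hc) (norm_nonneg _)
    rw [this, zero_mul] at hMN; linarith
  -- the second family of series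
  have hv : ∀ c : ℝ, HasSum (fun n : ℕ => ((Real.log n - c : ℝ) : ℂ) * u n) 0 := by
    intro c
    have := hu'.sub (hu.mul_left (c : ℂ))
    simp only [mul_zero, sub_zero] at this
    have e : (fun n : ℕ => ((Real.log n - c : ℝ) : ℂ) * u n) =
        fun n : ℕ => ((Real.log n : ℝ) : ℂ) * u n - (c : ℂ) * u n := by
      funext n; push_cast; ring
    rw [e]; exact this
  have hvn : ∀ (c : ℝ) (n : ℕ), ‖((Real.log n - c : ℝ) : ℂ) * u n‖ = |Real.log n - c| * ‖u n‖ := by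
    intro c n; rw [norm_mul, Complex.norm_real, Real.norm_eq_abs]
  have hyR : ∀ n : ℕ, M + 2 ≤ n → 0 ≤ Real.log n - Real.log N := by
    intro n hn
    have : N ≤ n := by rw [hN]; exact_mod_cast (by omega : M + 1 ≤ n)
    exact sub_nonneg.mpr (Real.log_le_log hN0 this)
  have hyL : ∀ n : ℕ, 2 ≤ n → n < M → 0 ≤ Real.log M - Real.log n := by
    intro n hn hnM
    exact sub_nonneg.mpr (log_cast_lt n M (by omega) hnM).le
  rcases le_total x 0 with hx0 | hx0
  · -- x ≤ 0
    obtain ⟨ξ, rfl⟩ : ∃ ξ, x = -(N * ξ) := ⟨-x / N, by field_simp⟩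
    have hξ0 : 0 ≤ ξ := by
      by_contra hc; push Not at hc; nlinarith
    have hξ1 : ξ ≤ lam := by
      by_contra hc; push Not at hc; nlinarith
    set A := ‖u M‖
    set B := ‖u (M + 1)‖
    have hAB : A ≤ B * Real.exp (-ξ) := by
      rw [hMN]
      apply mul_le_mul_of_nonneg_left _ hBpos.le
      apply Real.exp_le_exp.mpr
      nlinarith
    have hMξ : 0 ≤ (M : ℝ) * ξ := by positivity
    rcases le_total (Real.exp (-ξ)) (5 / 9) with hvv | hvv
    · have num := num1 ξ hξ1 hvv
      have hG : Real.exp (-ξ) / 9 = Real.exp (-(2 * lam + ξ)) := by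
        have := exp_two_log 0
        simp only [sub_zero, neg_zero, Real.exp_zero, mul_one] at this
        rw [neg_add, Real.exp_add, this]; ring
      have mas := (master M hM u hu A (Real.exp (-ξ) / 9) B ((2 * M + 3) * lam + -(N * ξ))
        (2 * lam - ξ) hpos.le hBpos.le (by positivity) (by linarith) (by linarith) (by linarith)
        (by rw [hN]; linarith) ?_ hR).2
      · have t : A * (Real.exp (-ξ) / 9 / (1 - Real.exp (-ξ) / 9)) ≤
          B * Real.exp (-ξ) * (Real.exp (-ξ) / 9 / (1 - Real.exp (-ξ) / 9)) := by
          apply mul_le_mul_of_nonneg_right hAB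
          exact div_nonneg (by positivity) (by linarith)
        have := mul_lt_mul_of_pos_left num hBpos
        simp only [← hlam] at this
        nlinarith
      · intro n hn
        rcases lt_or_ge n 2 with h2 | h2
        · rw [hsm n h2, norm_zero]; positivity
        · refine (hL n h2 hn).trans ?_
          apply mul_le_mul_of_nonneg_left _ hpos.le
          rw [hG]
          exact exp_pow_le M (M - n) _ _ _ (by linarith) (by rw [hN]; nlinarith) (hyL n h2 hn)
            (log_gap_left M n (by omega) hn)
    · have num := num2 ξ hξ0 hvv
      have hG : Real.exp 1 * Real.exp (-ξ) / 9 = Real.exp (-(2 * lam + ξ - 1)) := by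
        have := exp_two_log 0
        simp only [sub_zero, neg_zero, Real.exp_zero, mul_one] at this
        rw [show -(2 * lam + ξ - 1) = 1 + -ξ + -(2 * lam) by ring, Real.exp_add, Real.exp_add, this]
        ring
      have hG1 : Real.exp 1 * Real.exp (-ξ) / 9 < 1 := by
        rw [hG, Real.exp_lt_one_iff]; linarith
      have mas := (master M hM _ (hv (Real.log M)) (h * Real.exp (-1) * A)
        (Real.exp 1 * Real.exp (-ξ) / 9) (h * (2 * Real.exp (-(1 / 2))) * B)
        ((2 * M + 3) * lam + -(N * ξ) - N / 2)
        (2 * lam - ξ - 1 / 2) (by positivity) (by positivity) (by positivity) hG1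
        (by linarith) (by linarith) (by rw [hN]; linarith) ?_ ?_).2
      · simp only [hvn] at mas
        rw [sub_self, abs_zero, zero_mul, zero_add, show ((M + 1 : ℕ) : ℝ) = N by push_cast; rfl,
          ← hh, abs_of_pos hh0] at mas
        have t : A * (Real.exp 1 * Real.exp (-ξ) / 9 / (1 - Real.exp 1 * Real.exp (-ξ) / 9)) ≤
          B * Real.exp (-ξ) * (Real.exp 1 * Real.exp (-ξ) / 9 / (1 - Real.exp 1 * Real.exp (-ξ) / 9)) := by
          apply mul_le_mul_of_nonneg_right hAB
          exact div_nonneg (by positivity) (by linarith)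
        have t2 := mul_le_mul_of_nonneg_left t (show 0 ≤ h * Real.exp (-1) by positivity)
        have := mul_lt_mul_of_pos_left num (mul_pos hh0 hBpos)
        simp only [← hlam] at this
        nlinarith
      · intro n hn
        rcases lt_or_ge n 2 with h2 | h2
        · rw [hsm n h2, mul_zero, norm_zero]; positivity
        · rw [hvn, abs_sub_comm, abs_of_nonneg (hyL n h2 hn)]
          refine (combine _ _ _ _ _ _ _ (hyL n h2 hn) hpos.le (hL n h2 hn)
            (weight1 N h _ hN0 hNh)).trans ?_
          apply mul_le_mul_of_nonneg_left _ (by positivity)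
          rw [hG]
          exact exp_pow_le M (M - n) _ _ _ (by linarith) (by rw [hN]; nlinarith) (hyL n h2 hn)
            (log_gap_left M n (by omega) hn)
      · intro n hn
        have hy := hyR n hn
        have e : Real.log n - Real.log M = h + (Real.log n - Real.log N) := by rw [hh]; ring
        rw [hvn, e, abs_of_nonneg (by linarith)]
        exact combine _ _ _ _ _ _ _ (by linarith) hBpos.le (hR n hn) (weight2 N h _ hNh hh0 hy)
  · -- x ≥ 0
    obtain ⟨ξ, rfl⟩ : ∃ ξ, x = N * ξ := ⟨x / N, by field_simp⟩
    have hξ0 : 0 ≤ ξ := by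
      by_contra hc; push Not at hc; nlinarith
    have hξ1 : ξ ≤ lam := by
      by_contra hc; push Not at hc; nlinarith
    set A := ‖u M‖
    set B := ‖u (M + 1)‖
    have hAB : B ≤ A * Real.exp (-ξ) := by
      rw [hMN, mul_assoc, ← Real.exp_add]
      have : 1 ≤ Real.exp (N * ξ * h + -ξ) := by
        apply Real.one_le_exp; nlinarith
      nlinarith
    have hNξ : 0 ≤ N * ξ := by positivity
    rcases le_total (Real.exp (-ξ)) (5 / 9) with hvv | hvv
    · have num := num3 ξ hξ1 hvv
      have hG1 : Real.exp (-(2 * lam - ξ)) < 1 := by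
        rw [Real.exp_lt_one_iff]; linarith
      have mas := (master M hM u hu A (Real.exp (-(2 * lam - ξ))) B ((2 * M + 3) * lam + N * ξ)
        (2 * lam) hpos.le hBpos.le (by positivity) hG1 (by linarith) (by linarith)
        (by linarith) ?_ hR).1
      · have hq : 0 ≤ Real.exp (-(2 * lam)) / (1 - Real.exp (-(2 * (2 * lam) / 3))) := by
          apply div_nonneg (by positivity)
          rw [sub_nonneg, Real.exp_le_one_iff]; linarith
        have t := mul_le_mul_of_nonneg_right hAB hq
        have := mul_lt_mul_of_pos_left num hpos
        simp only [← hlam] at this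
        nlinarith
      · intro n hn
        rcases lt_or_ge n 2 with h2 | h2
        · rw [hsm n h2, norm_zero]; positivity
        · refine (hL n h2 hn).trans ?_
          apply mul_le_mul_of_nonneg_left _ hpos.le
          exact exp_pow_le M (M - n) _ _ _ (by linarith) (by rw [hN]; nlinarith) (hyL n h2 hn)
            (log_gap_left M n (by omega) hn)
    · have num := num4 ξ hξ0 hvv
      have hG1 : Real.exp (-(2 * lam - ξ - 1 / 2)) < 1 := by
        rw [Real.exp_lt_one_iff]; linarith
      have mas := (master M hM _ (hv (Real.log N)) (h * (2 * Real.exp (-(1 / 2))) * A)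
        (Real.exp (-(2 * lam - ξ - 1 / 2))) (h * Real.exp (-1) * B)
        ((2 * M + 3) * lam + N * ξ - N)
        (2 * lam - 1) (by positivity) (by positivity) (by positivity) hG1
        (by linarith) (by linarith) (by linarith) ?_ ?_).1
      · simp only [hvn] at mas
        rw [show ((M + 1 : ℕ) : ℝ) = N by push_cast; rfl, sub_self, abs_zero, zero_mul, zero_add,
          abs_sub_comm, ← hh, abs_of_pos hh0] at mas
        have hq : 0 ≤ Real.exp (-(2 * lam - 1)) / (1 - Real.exp (-(2 * (2 * lam - 1) / 3))) := by
          apply div_nonneg (by positivity)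
          rw [sub_nonneg, Real.exp_le_one_iff]; linarith
        have t := mul_le_mul_of_nonneg_right hAB hq
        have t2 := mul_le_mul_of_nonneg_left t (show 0 ≤ h * Real.exp (-1) by positivity)
        have := mul_lt_mul_of_pos_left num (mul_pos hh0 hpos)
        simp only [← hlam] at this
        nlinarith
      · intro n hn
        rcases lt_or_ge n 2 with h2 | h2
        · rw [hsm n h2, mul_zero, norm_zero]; positivity
        · have hy := hyL n h2 hn
          have e : Real.log N - Real.log n = h + (Real.log M - Real.log n) := by rw [hh]; ring
          rw [hvn, abs_sub_comm, e, abs_of_nonneg (by linarith)]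
          refine (combine _ _ _ _ _ _ _ (by linarith) hpos.le (hL n h2 hn)
            (weight2 N h _ hNh hh0 hy)).trans ?_
          apply mul_le_mul_of_nonneg_left _ (by positivity)
          exact exp_pow_le M (M - n) _ _ _ (by linarith) (by rw [hN]; nlinarith) (hyL n h2 hn)
            (log_gap_left M n (by omega) hn)
      · intro n hn
        have hy := hyR n hn
        rw [hvn, abs_of_nonneg hy]
        exact combine _ _ _ _ _ _ _ hy hBpos.le (hR n hn) (weight1 N h _ hN0 hNh)

/-- If the critical strip `S_M^k` exists, then every zero of the `k`-th derivative of the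
Riemann zeta function inside `S_M^k` is simple. -/
theorem zeta_deriv_zeros_simple (M k : ℕ) (hM : 2 ≤ M) (hk : 3 ≤ k)
    (hex : q (M + 1) * k + ((M : ℝ) + 2) * Real.log 3 <
      q M * k - ((M : ℝ) + 1) * Real.log 3)
    (s : ℂ)
    (h1 : q M * k - ((M : ℝ) + 1) * Real.log 3 ≤ s.re)
    (h2 : s.re ≤ q M * k + ((M : ℝ) + 1) * Real.log 3)
    (hz : iteratedDeriv k riemannZeta s = 0) :
    iteratedDeriv (k + 1) riemannZeta s ≠ 0 := by
  intro hz'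
  have l3 := log_three_gt
  have hM' : (2 : ℝ) ≤ M := by exact_mod_cast hM
  have hqN := q_pos (M + 1) (by omega)
  have hk0 : (0 : ℝ) ≤ k := by positivity
  have hs : 1 < s.re := by
    have : 0 ≤ q (M + 1) * k := by positivity
    nlinarith
  have hu := zeta_hasSum k (by omega) s hs hz
  have hu' := zeta_hasSum (k + 1) (by omega) s hs hz'
  have hu'' : HasSum (fun n : ℕ => ((Real.log n : ℝ) : ℂ) * zterm k s n) 0 := by
    convert hu' using 1
    funext n
    simp only [zterm]; ring
  have lMN := log_cast_lt M (M + 1) (by omega) (by omega)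
  refine core M hM (zterm k s) hu hu'' (fun n hn => zterm_small k (by omega) s n hn)
    (s.re - q M * k) (by linarith) (by linarith) ?_ ?_ ?_ ?_
  · rw [zterm_norm k s M hM]; positivity
  · rw [zterm_norm k s M hM, zterm_norm k s (M + 1) (by omega), ← Real.exp_add]
    congr 1
    have e := q_eq M hM
    rw [eq_div_iff (by linarith)] at e
    push_cast at *
    linear_combination (k : ℝ) * e
  · intro n hn
    rw [zterm_norm k s n (by omega), zterm_norm k s (M + 1) (by omega), ← Real.exp_add]
    apply Real.exp_le_exp.mpr
    have hq := mul_le_mul_of_nonneg_left (q_right (M + 1) n (by omega) hn) hk0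
    have hy := log_cast_lt (M + 1) n (by omega) (by omega)
    have hτ : (2 * M + 3) * Real.log 3 + (s.re - q M * k) ≤ s.re - q (M + 1) * k := by linarith
    have := mul_le_mul_of_nonneg_right hτ (sub_nonneg.mpr hy.le)
    push_cast at *
    nlinarith
  · intro n hn hnM
    obtain ⟨m, rfl⟩ : ∃ m, M = m + 1 := ⟨M - 1, by omega⟩
    rw [zterm_norm k s n (by omega), zterm_norm k s (m + 1) (by omega), ← Real.exp_add]
    apply Real.exp_le_exp.mpr
    have hq := mul_le_mul_of_nonneg_left (q_left m n hn (by omega)) hk0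
    have hc := mul_le_mul_of_nonneg_right (q_convex m (by omega)) hk0
    have hy := log_cast_lt n (m + 1) (by omega) (by omega)
    have hτ : (2 * (m + 1 : ℕ) + 3) * Real.log 3 - (s.re - q (m + 1) * k) ≤ q m * k - s.re := by
      rw [show m + 1 + 1 = m + 2 by ring] at hex
      linarith
    have := mul_le_mul_of_nonneg_right hτ (sub_nonneg.mpr hy.le)
    nlinarith
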